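/- For any factor of a Sturmian word and any length l ≥ 2, the abelian return words of that factor include at most one abelian equivalence class of words of length l. -/

import Mathlib

variable {α : Type*}

/-- The factor of the infinite word `w` of length `n` starting at position `i`. -/
def factorAt (w : ℕ → α) (i n : ℕ) : List α :=
  (List.range n).map fun k => w (i + k)

/-- `u` is a factor of the infinite word `w`. -/
def IsFactor (w : ℕ → α) (u : List α) : Prop :=
  ∃ i, factorAt w i u.length = u

/-- `w` is recurrent: each of its factors occurs infinitely many times. -/
def Recurrent (w : ℕ → α) : Prop :=
  ∀ u : List α, IsFactor w u → ∀ N : ℕ, ∃ i, N ≤ i ∧ factorAt w i u.length = u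

/-- `w` is periodic: there is `T > 0` with `w (n + T) = w n` for all `n`. -/
def Periodic (w : ℕ → α) : Prop :=
  ∃ T : ℕ, 0 < T ∧ ∀ n, w (n + T) = w n

def Aperiodic (w : ℕ → α) : Prop := ¬ Periodic w

def UltimatelyPeriodic (w : ℕ → α) : Prop :=
  ∃ N T : ℕ, 0 < T ∧ ∀ n, N ≤ n → w (n + T) = w n

/-- `w` is Sturmian: aperiodic with subword complexity `n + 1`. -/
def Sturmian (w : ℕ → α) : Prop :=
  Aperiodic w ∧ ∀ n : ℕ, {u : List α | u.length = n ∧ IsFactor w u}.ncard = n + 1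

/-- Positions where `u` occurs in `w`. -/
def Occurrences (w : ℕ → α) (u : List α) : Set ℕ :=
  {i | factorAt w i u.length = u}

/-- The return words of `u` in `w`: words from one occurrence of `u` to the next. -/
def ReturnWords (w : ℕ → α) (u : List α) : Set (List α) :=
  {r | ∃ i j : ℕ, i ∈ Occurrences w u ∧ j ∈ Occurrences w u ∧ i < j ∧
    (∀ k, i < k → k < j → k ∉ Occurrences w u) ∧ r = factorAt w i (j - i)}

/-- Positions where a word abelian-equivalent to `u` occurs in `w`. -/
def AbelianOccurrences (w : ℕ → α) (u : List α) : Set ℕ :=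
  {i | List.Perm (factorAt w i u.length) u}

/-- The abelian return words of `u` in `w`. -/
def AbelianReturnWords (w : ℕ → α) (u : List α) : Set (List α) :=
  {r | ∃ i j : ℕ, i ∈ AbelianOccurrences w u ∧ j ∈ AbelianOccurrences w u ∧ i < j ∧
    (∀ k, i < k → k < j → k ∉ AbelianOccurrences w u) ∧ r = factorAt w i (j - i)}

/-- The abelian equivalence classes (as multisets) of the abelian return words of `u` in `w`. -/
def abelianReturnClasses (w : ℕ → α) (u : List α) : Set (Multiset α) :=
  (fun r : List α => (r : Multiset α)) '' AbelianReturnWords w u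

def RightSpecial (w : ℕ → α) (u : List α) : Prop :=
  ∃ a b : α, a ≠ b ∧ IsFactor w (u ++ [a]) ∧ IsFactor w (u ++ [b])

def LeftSpecial (w : ℕ → α) (u : List α) : Prop :=
  ∃ a b : α, a ≠ b ∧ IsFactor w (a :: u) ∧ IsFactor w (b :: u)

def Bispecial (w : ℕ → α) (u : List α) : Prop :=
  RightSpecial w u ∧ LeftSpecial w u

/-- A factor is singular if it is the only factor of `w` in its abelian class. -/
def Singular (w : ℕ → α) (u : List α) : Prop :=
  ∀ v : List α, IsFactor w v → List.Perm v u → v = u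

/-- `w` is an infinite concatenation of words from `S`. -/
def InfConcat (S : Set (List α)) (w : ℕ → α) : Prop :=
  ∃ f : ℕ → List α, (∀ n, f n ∈ S) ∧
    ∀ n, factorAt w (((List.range n).map fun k => (f k).length).sum) (f n).length = f n

/-- A finite binary word is balanced if any two factors of equal length have numbers
of occurrences of `true` differing by at most one. -/
def BalancedList (w : List Bool) : Prop :=
  ∀ u v : List Bool, u <:+: w → v <:+: w → u.length = v.length →
    |(u.count true : ℤ) - (v.count true : ℤ)| ≤ 1


/-- The letter of `w` at position `i`, read as an integer. -/
def letterValue (w : ℕ → Bool) (i : ℕ) : ℤ := (w i).toNat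

/-- The number of letters `true` among the `n` letters of `w` from position `i` on. -/
def onesCount (w : ℕ → Bool) (i n : ℕ) : ℤ := ((factorAt w i n).count true : ℕ)

/-- The factor of length `L` at position `i` is right special: it occurs elsewhere, followed by
a different letter. -/
def RightSpecialAt (w : ℕ → α) (L i : ℕ) : Prop :=
  ∃ j, factorAt w j L = factorAt w i L ∧ w (j + L) ≠ w (i + L)

section Factors

variable (w : ℕ → α)

@[simp]
lemma length_factorAt (i n : ℕ) : (factorAt w i n).length = n := by
  simp [factorAt]

lemma factorAt_succ (i n : ℕ) : factorAt w i (n + 1) = factorAt w i n ++ [w (i + n)] := by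
  simp [factorAt, List.range_succ]

lemma factorAt_add (i m n : ℕ) :
    factorAt w i (m + n) = factorAt w i m ++ factorAt w (i + m) n := by
  induction n with
  | zero => simp [factorAt]
  | succ n ih => rw [← add_assoc, factorAt_succ, ih, factorAt_succ, List.append_assoc, add_assoc]

variable {w}

lemma factorAt_eq_iff {i j n : ℕ} :
    factorAt w i n = factorAt w j n ↔ ∀ k < n, w (i + k) = w (j + k) := by
  simp [factorAt]

lemma factorAt_succ_eq_iff {i j n : ℕ} :
    factorAt w i (n + 1) = factorAt w j (n + 1) ↔
      factorAt w i n = factorAt w j n ∧ w (i + n) = w (j + n) := by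
  simp only [factorAt_eq_iff, Nat.lt_succ_iff_lt_or_eq, or_imp, forall_and, forall_eq]

lemma factorAt_succ_eq_iff' {i j n : ℕ} :
    factorAt w i (n + 1) = factorAt w j (n + 1) ↔
      w i = w j ∧ factorAt w (i + 1) n = factorAt w (j + 1) n := by
  rw [add_comm n 1, factorAt_add, factorAt_add]
  simp [factorAt]

lemma setOf_isFactor (L : ℕ) :
    {u : List α | u.length = L ∧ IsFactor w u} = Set.range fun i => factorAt w i L := by
  ext u
  constructor
  · rintro ⟨rfl, i, hi⟩
    exact ⟨i, hi⟩
  · rintro ⟨i, rfl⟩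
    exact ⟨by simp, i, by simp⟩

lemma Sturmian.ncard_range (hw : Sturmian w) (L : ℕ) :
    (Set.range fun i => factorAt w i L).ncard = L + 1 := by
  rw [← setOf_isFactor, hw.2]

lemma Sturmian.finite_range (hw : Sturmian w) (L : ℕ) :
    (Set.range fun i => factorAt w i L).Finite :=
  Set.finite_of_ncard_ne_zero (by rw [hw.ncard_range]; omega)

lemma RightSpecialAt.congr {L i i' : ℕ} (h : RightSpecialAt w L i)
    (hi : factorAt w i L = factorAt w i' L) : RightSpecialAt w L i' := by
  obtain ⟨j, hj, hne⟩ := h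
  by_cases hw : w (i + L) = w (i' + L)
  · exact ⟨j, hj.trans hi, hw ▸ hne⟩
  · exact ⟨i, hi, hw⟩

lemma RightSpecialAt.tail {L i : ℕ} (h : RightSpecialAt w (L + 1) i) :
    RightSpecialAt w L (i + 1) := by
  obtain ⟨j, hj, hne⟩ := h
  exact ⟨j + 1, (factorAt_succ_eq_iff'.1 hj).2, by
    rwa [show j + 1 + L = j + (L + 1) by ring, show i + 1 + L = i + (L + 1) by ring]⟩

/-- A Sturmian word has exactly one right special factor of each length. -/
lemma Sturmian.exists_unique_rightSpecialAt (hw : Sturmian w) (L : ℕ) :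
    ∃ p, RightSpecialAt w L p ∧
      ∀ i, RightSpecialAt w L i → factorAt w i L = factorAt w p L := by
  set F : ℕ → Set (List α) := fun L => Set.range fun i => factorAt w i L
  have hpos : ∀ x : F L, ∃ i, factorAt w i L = x := fun x => x.2
  choose pos hpos using hpos
  let σ : F L → List α := fun x => factorAt w (pos x) (L + 1)
  have hσ_inj : Function.Injective σ := fun x y h => by
    have h' := (factorAt_succ_eq_iff.1 h).1
    rw [hpos, hpos] at h'
    exact Subtype.ext h'
  have hsub : Set.range σ ⊆ F (L + 1) := by
    rintro _ ⟨x, rfl⟩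
    exact ⟨_, rfl⟩
  have hcard : (F (L + 1) \ Set.range σ).ncard = 1 := by
    have h1 : (Set.range σ).ncard = L + 1 := by
      rw [← hw.ncard_range L, ← Set.image_univ, Set.ncard_image_of_injective _ hσ_inj,
        Set.ncard_univ]
      rfl
    have h2 := Set.ncard_sdiff_add_ncard_of_subset hsub (hw.finite_range (L + 1))
    have h3 : (F (L + 1)).ncard = L + 1 + 1 := hw.ncard_range (L + 1)
    omega
  obtain ⟨e, he⟩ := Set.ncard_eq_one.1 hcard
  have he' : e ∈ F (L + 1) \ Set.range σ := he ▸ rfl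
  obtain ⟨⟨p, rfl⟩, hp⟩ := he'
  have hout : ∀ i, factorAt w i L ≠ factorAt w p L →
      w (pos ⟨factorAt w i L, i, rfl⟩ + L) = w (i + L) := by
    intro i h2
    by_contra h1
    have hi : factorAt w i (L + 1) ∈ F (L + 1) \ Set.range σ := by
      refine ⟨⟨i, rfl⟩, ?_⟩
      rintro ⟨x, hx⟩
      obtain ⟨h3, h4⟩ := factorAt_succ_eq_iff.1 hx
      rw [hpos] at h3
      obtain rfl : x = ⟨factorAt w i L, i, rfl⟩ := Subtype.ext h3
      exact h1 h4
    rw [he] at hi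
    exact h2 (factorAt_succ_eq_iff.1 hi).1
  refine ⟨p, ⟨pos ⟨factorAt w p L, p, rfl⟩, hpos _, fun h => hp ⟨⟨factorAt w p L, p, rfl⟩, ?_⟩⟩, ?_⟩
  · exact factorAt_succ_eq_iff.2 ⟨hpos _, h⟩
  · rintro i ⟨j, hj, hne⟩
    by_contra hc
    have hi := hout i hc
    have hj' := hout j (hj ▸ hc)
    simp only [hj] at hj'
    exact hne (hj'.symm.trans hi)

lemma Sturmian.not_ultimatelyPeriodic (hw : Sturmian w) : ¬ UltimatelyPeriodic w := by
  rintro ⟨N, T, hT, h⟩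
  have hred : ∀ i, ∃ i' < N + T, ∀ k, w (i + k) = w (i' + k) := by
    intro i
    induction i using Nat.strong_induction_on with
    | _ i ih =>
      by_cases hi : i < N + T
      · exact ⟨i, hi, fun _ => rfl⟩
      · obtain ⟨i', hi', hk⟩ := ih (i - T) (by omega)
        refine ⟨i', hi', fun k => ?_⟩
        rw [← hk k, ← h (i - T + k) (by omega)]
        congr 1
        omega
  have hsub : (Set.range fun i => factorAt w i (N + T)) ⊆
      (fun i => factorAt w i (N + T)) '' Set.Iio (N + T) := by
    rintro _ ⟨i, rfl⟩
    obtain ⟨i', hi', hk⟩ := hred i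
    exact ⟨i', hi', factorAt_eq_iff.2 fun k _ => (hk k).symm⟩
  have h1 := Set.ncard_le_ncard hsub ((Set.finite_Iio _).image _)
  have h2 := Set.ncard_image_le (f := fun i => factorAt w i (N + T)) (Set.finite_Iio (N + T))
  rw [hw.ncard_range] at h1
  have h3 : (Set.Iio (N + T)).ncard = N + T := by
    rw [← Finset.coe_Iio, Set.ncard_coe_finset, Nat.card_Iio]
  omega

/-- A repetition among the factors of length `L` with no right special factor in between propagates
forever. -/
lemma ultimatelyPeriodic_of_not_rightSpecialAt {L b T : ℕ} (hL : 0 < L) (hT : 0 < T)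
    (heq : factorAt w b L = factorAt w (b + T) L)
    (hns : ∀ t < T, ¬ RightSpecialAt w L (b + t)) : UltimatelyPeriodic w := by
  have key : ∀ t, factorAt w (b + t) L = factorAt w (b + t + T) L ∧
      ¬ RightSpecialAt w L (b + t) := by
    intro t
    induction t using Nat.strong_induction_on with
    | _ t ih =>
      constructor
      · cases t with
        | zero => simpa using heq
        | succ t =>
          obtain ⟨h1, h2⟩ := ih t (by omega)
          have h3 : w (b + t + T + L) = w (b + t + L) := by
            by_contra hc
            exact h2 ⟨_, h1.symm, hc⟩
          have h4 := (factorAt_succ_eq_iff'.1 (factorAt_succ_eq_iff.2 ⟨h1, h3.symm⟩)).2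
          rw [show b + t + T + 1 = b + (t + 1) + T by ring] at h4
          exact h4
      · by_cases ht : t < T
        · exact hns t ht
        · obtain ⟨h1, h2⟩ := ih (t - T) (by omega)
          rw [show b + (t - T) + T = b + t by omega] at h1
          exact fun h => h2 (h.congr h1.symm)
  refine ⟨b, T, hT, fun n hn => ?_⟩
  have h := factorAt_eq_iff.1 (key (n - b)).1 0 hL
  rw [show b + (n - b) = n by omega] at h
  exact h.symm

end Factors

lemma Sturmian.rightSpecialAt_of_palindrome {w : ℕ → Bool} (hw : Sturmian w) {i j N : ℕ}
    (hij : w i ≠ w j) (hmid : factorAt w (i + 1) N = factorAt w (j + 1) N)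
    (hi : w (i + N + 1) = w i) (hj : w (j + N + 1) = w j)
    (hpal : ∀ k, 1 ≤ k → k ≤ N → w (i + k) = w (i + N + 1 - k)) :
    RightSpecialAt w (N + 1) i := by
  by_contra hns
  obtain ⟨p, hp, hpu⟩ := hw.exists_unique_rightSpecialAt (N + 1)
  obtain ⟨q, -, hqu⟩ := hw.exists_unique_rightSpecialAt N
  have hi1 : RightSpecialAt w N (i + 1) := ⟨j + 1, hmid.symm, by
    rw [show j + 1 + N = j + N + 1 by ring, show i + 1 + N = i + N + 1 by ring, hi, hj]
    exact hij.symm⟩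
  have hpi : factorAt w (p + 1) N = factorAt w (i + 1) N :=
    (hqu _ hp.tail).trans (hqu _ hi1).symm
  have hwp : w p ≠ w i := fun h => hns (hp.congr (factorAt_succ_eq_iff'.2 ⟨h, hpi⟩))
  have havoid : ∀ t ≤ N + 1, factorAt w (i + t) (N + 1) ≠ factorAt w p (N + 1) := by
    intro t ht h
    obtain ⟨h1, h2⟩ := factorAt_succ_eq_iff'.1 h
    have h3 := h2.trans hpi
    rcases Nat.eq_zero_or_pos t with rfl | ht0
    · exact hwp h1.symm
    rcases Nat.lt_or_ge N t with htN | htN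
    · obtain rfl : t = N + 1 := by omega
      exact hwp (h1.symm.trans hi)
    · have hmir := hpal t ht0 htN
      have h4 : w (i + t + 1 + (N - t)) = w (i + 1 + (N - t)) :=
        factorAt_eq_iff.1 h3 (N - t) (by omega)
      rw [show i + t + 1 + (N - t) = i + N + 1 by omega, hi,
        show i + 1 + (N - t) = i + N + 1 - t by omega, ← hmir, h1] at h4
      exact hwp h4.symm
  have hfin := (hw.finite_range (N + 1)).subset
    (Set.sdiff_subset (t := {factorAt w p (N + 1)}))
  have hcard : hfin.toFinset.card < (Finset.range (N + 2)).card := by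
    rw [← Set.ncard_eq_toFinset_card _ hfin, Set.ncard_sdiff_singleton_of_mem (Set.mem_range_self p),
      hw.ncard_range, Finset.card_range]
    omega
  obtain ⟨s, hs, t, ht, hst, heq⟩ := Finset.exists_ne_map_eq_of_card_lt_of_maps_to hcard
    (f := fun t => factorAt w (i + t) (N + 1)) (fun t ht => by
      have ht' : t < N + 2 := by simpa using ht
      simpa using havoid t (by omega))
  have hlt : ∀ s t, s < t → t < N + 2 →
      factorAt w (i + s) (N + 1) = factorAt w (i + t) (N + 1) → False := by
    intro s t hst ht heq
    refine hw.not_ultimatelyPeriodic (ultimatelyPeriodic_of_not_rightSpecialAt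
      (L := N + 1) (b := i + s) (T := t - s) (by omega) (by omega) ?_ ?_)
    · rwa [show i + s + (t - s) = i + t by omega]
    · intro r hr h
      rw [add_assoc] at h
      exact havoid (s + r) (by omega) (hpu _ h)
  rw [Finset.mem_range] at hs ht
  rcases lt_or_gt_of_ne hst with h | h
  · exact hlt s t h ht heq
  · exact hlt t s h hs heq.symm

section Counting

variable {w : ℕ → Bool}

lemma letterValue_bounds (w : ℕ → Bool) (i : ℕ) : 0 ≤ letterValue w i ∧ letterValue w i ≤ 1 := by
  unfold letterValue
  cases w i <;> simp

lemma letterValue_eq_iff {i j : ℕ} : letterValue w i = letterValue w j ↔ w i = w j := by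
  unfold letterValue
  cases w i <;> cases w j <;> simp

@[simp]
lemma onesCount_zero (w : ℕ → Bool) (i : ℕ) : onesCount w i 0 = 0 := by
  simp [onesCount, factorAt]

lemma onesCount_add (w : ℕ → Bool) (i m n : ℕ) :
    onesCount w i (m + n) = onesCount w i m + onesCount w (i + m) n := by
  simp [onesCount, factorAt_add]

@[simp]
lemma onesCount_one (w : ℕ → Bool) (i : ℕ) : onesCount w i 1 = letterValue w i := by
  cases h : w i <;> simp [onesCount, letterValue, factorAt, h]

lemma onesCount_succ (w : ℕ → Bool) (i n : ℕ) :
    onesCount w i (n + 1) = onesCount w i n + letterValue w (i + n) := by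
  rw [onesCount_add, onesCount_one]

lemma onesCount_succ' (w : ℕ → Bool) (i n : ℕ) :
    onesCount w i (n + 1) = letterValue w i + onesCount w (i + 1) n := by
  rw [add_comm n 1, onesCount_add, onesCount_one]

lemma perm_iff_count_true {u v : List Bool} (h : u.length = v.length) :
    u.Perm v ↔ u.count true = v.count true := by
  refine ⟨fun hp => hp.count_eq true, fun hc => List.perm_iff_count.2 fun b => ?_⟩
  have h1 := List.count_true_add_count_false u
  have h2 := List.count_true_add_count_false v
  cases b <;> omega

/-- Sturmian words are balanced. -/
lemma Sturmian.onesCount_le (hw : Sturmian w) (n i j : ℕ) :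
    onesCount w i n ≤ onesCount w j n + 1 := by
  induction n using Nat.strong_induction_on generalizing i j with
  | _ n ih =>
    by_contra! hc
    have hn : 2 ≤ n := by
      by_contra! hn
      have hi := letterValue_bounds w i
      have hj := letterValue_bounds w j
      interval_cases n
      · simp at hc
      · rw [onesCount_one, onesCount_one] at hc
        omega
    obtain ⟨N, rfl⟩ := Nat.exists_eq_add_of_le hn
    have hpre : ∀ m ≤ N, onesCount w i (m + 1) = onesCount w j (m + 1) + 1 := by
      intro m hm
      have h1 := ih (m + 1) (by omega) i j
      have h2 := ih (N + 1 - m) (by omega) (i + (m + 1)) (j + (m + 1))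
      have h3 := onesCount_add w i (m + 1) (N + 1 - m)
      have h4 := onesCount_add w j (m + 1) (N + 1 - m)
      rw [show m + 1 + (N + 1 - m) = 2 + N by omega] at h3 h4
      omega
    have hwi : letterValue w i = 1 ∧ letterValue w j = 0 := by
      have h := hpre 0 (by omega)
      simp only [zero_add, onesCount_one] at h
      have hi := letterValue_bounds w i
      have hj := letterValue_bounds w j
      omega
    have hend : letterValue w (i + N + 1) = 1 ∧ letterValue w (j + N + 1) = 0 := by
      have h := hpre N le_rfl
      have h1 := onesCount_succ w i (N + 1)
      have h2 := onesCount_succ w j (N + 1)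
      rw [show N + 1 + 1 = 2 + N by ring, ← add_assoc] at h1 h2
      have hi := letterValue_bounds w (i + N + 1)
      have hj := letterValue_bounds w (j + N + 1)
      omega
    have hmid : ∀ k, 1 ≤ k → k ≤ N → letterValue w (i + k) = letterValue w (j + k) := by
      intro k hk hkN
      have h1 := hpre k hkN
      have h2 := hpre (k - 1) (by omega)
      rw [show k - 1 + 1 = k by omega] at h2
      rw [onesCount_succ, onesCount_succ] at h1
      omega
    have hsum : ∀ k ≤ N, onesCount w i (k + 1) + onesCount w (i + N + 1 - k) (k + 1)
        = onesCount w j (k + 1) + onesCount w (j + N + 1 - k) (k + 1) + 2 := by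
      intro k hk
      induction k with
      | zero =>
        simp only [zero_add, onesCount_one, Nat.sub_zero]
        omega
      | succ k ihk =>
        have h0 := ihk (by omega)
        have h1 := onesCount_succ w i (k + 1)
        have h2 := onesCount_succ w j (k + 1)
        have h3 := onesCount_succ' w (i + N + 1 - (k + 1)) (k + 1)
        have h4 := onesCount_succ' w (j + N + 1 - (k + 1)) (k + 1)
        have h5 := hmid (k + 1) (by omega) hk
        have h6 := hmid (N - k) (by omega) (by omega)
        rw [show i + N + 1 - (k + 1) + 1 = i + N + 1 - k by omega] at h3
        rw [show j + N + 1 - (k + 1) + 1 = j + N + 1 - k by omega] at h4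
        rw [show i + (N - k) = i + N + 1 - (k + 1) by omega,
          show j + (N - k) = j + N + 1 - (k + 1) by omega] at h6
        omega
    have hcross : ∀ k ≤ N, onesCount w i (k + 1) = onesCount w (j + N + 1 - k) (k + 1) + 1 := by
      intro k hk
      have h1 := ih (k + 1) (by omega) i (j + N + 1 - k)
      have h2 := ih (k + 1) (by omega) (i + N + 1 - k) j
      have h3 := hsum k hk
      omega
    have hpal : ∀ k, 1 ≤ k → k ≤ N → w (i + k) = w (j + N + 1 - k) := by
      intro k hk hkN
      have h1 := hcross k hkN
      have h2 := hcross (k - 1) (by omega)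
      rw [show k - 1 + 1 = k by omega, show j + N + 1 - (k - 1) = j + N + 1 - k + 1 by omega] at h2
      rw [onesCount_succ, onesCount_succ'] at h1
      exact letterValue_eq_iff.1 (by omega)
    have hfac : factorAt w (i + 1) N = factorAt w (j + 1) N := by
      refine factorAt_eq_iff.2 fun k hk => letterValue_eq_iff.1 ?_
      rw [add_assoc, add_assoc]
      exact hmid _ (by omega) (by omega)
    have hij : w i ≠ w j := fun h => by
      have := letterValue_eq_iff.2 h
      omega
    have hi : w (i + N + 1) = w i := letterValue_eq_iff.1 (by omega)
    have hj : w (j + N + 1) = w j := letterValue_eq_iff.1 (by omega)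
    have hmid' : ∀ k, 1 ≤ k → k ≤ N → w (i + k) = w (j + k) :=
      fun k h1 h2 => letterValue_eq_iff.1 (hmid k h1 h2)
    have hRi : RightSpecialAt w (N + 1) i := by
      refine hw.rightSpecialAt_of_palindrome hij hfac hi hj fun k h1 h2 => ?_
      rw [hpal k h1 h2, show j + N + 1 - k = j + (N + 1 - k) by omega,
        ← hmid' (N + 1 - k) (by omega) (by omega), show i + N + 1 - k = i + (N + 1 - k) by omega]
    have hRj : RightSpecialAt w (N + 1) j :=
      hw.rightSpecialAt_of_palindrome hij.symm hfac.symm hj hi fun k h1 h2 => by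
        rw [← hmid' k h1 h2, hpal k h1 h2]
    obtain ⟨p, -, hp⟩ := hw.exists_unique_rightSpecialAt (N + 1)
    exact hij (factorAt_succ_eq_iff'.1 ((hp i hRi).trans (hp j hRj).symm)).1

lemma mem_abelianOccurrences_iff {u : List Bool} {i : ℕ} :
    i ∈ AbelianOccurrences w u ↔ onesCount w i u.length = (u.count true : ℕ) := by
  rw [AbelianOccurrences, Set.mem_ofPred_eq, perm_iff_count_true (by simp), onesCount]
  norm_cast

/-- The data carried by an abelian return word of length at least two: the sign `d` of the change of
the number of ones, which is also the difference of its last and first letter. -/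
lemma Sturmian.exists_of_mem_abelianReturnWords (hw : Sturmian w) {u r : List Bool} {l : ℕ}
    (hr : r ∈ AbelianReturnWords w u) (hl : r.length = l + 2) :
    ∃ (i : ℕ) (d : ℤ), r = factorAt w i (l + 2) ∧
      onesCount w (i + 1) u.length = (u.count true : ℕ) + d ∧ (d = 1 ∨ d = -1) ∧
      letterValue w (i + l + 1) - letterValue w i = d := by
  obtain ⟨i, j, hi, hj, hij, hbetween, rfl⟩ := hr
  rw [length_factorAt] at hl
  obtain rfl : j = i + l + 2 := by omega
  have h1 := hbetween (i + 1) (by omega) (by omega)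
  have h2 := hbetween (i + l + 1) (by omega) (by omega)
  rw [mem_abelianOccurrences_iff] at hi hj h1 h2
  set n := u.length
  have e1 := (onesCount_succ w i n).symm.trans (onesCount_succ' w i n)
  have e2 := (onesCount_succ w (i + l + 1) n).symm.trans (onesCount_succ' w (i + l + 1) n)
  rw [show i + l + 1 + 1 = i + l + 2 by ring] at e2
  have b1 := letterValue_bounds w i
  have b2 := letterValue_bounds w (i + n)
  have b3 := letterValue_bounds w (i + l + 1)
  have b4 := letterValue_bounds w (i + l + 1 + n)
  have h3 := hw.onesCount_le n (i + 1) (i + l + 1)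
  have h4 := hw.onesCount_le n (i + l + 1) (i + 1)
  refine ⟨i, onesCount w (i + 1) n - (u.count true : ℕ), by rw [hl], ?_, ?_, ?_⟩ <;> omega

lemma Sturmian.onesCount_le_of_letterValue (hw : Sturmian w) {i j l : ℕ} {d : ℤ}
    (hd : d = 1 ∨ d = -1) (hi : letterValue w (i + l + 1) - letterValue w i = d)
    (hj : letterValue w (j + l + 1) - letterValue w j = d) :
    onesCount w i (l + 2) ≤ onesCount w j (l + 2) := by
  have i1 := onesCount_succ w i (l + 1)
  have i2 := onesCount_succ' w i (l + 1)
  have j1 := onesCount_succ w j (l + 1)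
  have j2 := onesCount_succ' w j (l + 1)
  rw [← add_assoc i l 1] at i1
  rw [← add_assoc j l 1] at j1
  have h1 := hw.onesCount_le (l + 1) (i + 1) j
  have h2 := hw.onesCount_le (l + 1) i (j + 1)
  have b1 := letterValue_bounds w i
  have b2 := letterValue_bounds w j
  have b3 := letterValue_bounds w (i + l + 1)
  have b4 := letterValue_bounds w (j + l + 1)
  rw [show l + 1 + 1 = l + 2 by ring] at i1 i2 j1 j2
  omega

end Counting

/-- For a factor of a Sturmian word and any length `l ≥ 2`, the abelian
return words of that factor include at most one abelian class of words of length `l`. -/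
theorem at_most_one_abelian_return_class_of_each_length (w : ℕ → Bool) (hw : Sturmian w)
    (u : List Bool) (hu : IsFactor w u) (l : ℕ) (hl : 2 ≤ l) :
    ∀ r s : List Bool, r ∈ AbelianReturnWords w u → s ∈ AbelianReturnWords w u →
      r.length = l → s.length = l → (r : Multiset Bool) = (s : Multiset Bool) := by
  intro r s hr hs hrl hsl
  obtain ⟨l, rfl⟩ := Nat.exists_eq_add_of_le' hl
  obtain ⟨i, d, rfl, hi, hd, hid⟩ := hw.exists_of_mem_abelianReturnWords hr hrl
  obtain ⟨j, e, rfl, hj, he, hje⟩ := hw.exists_of_mem_abelianReturnWords hs hsl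
  have h1 := hw.onesCount_le u.length (i + 1) (j + 1)
  have h2 := hw.onesCount_le u.length (j + 1) (i + 1)
  obtain rfl : d = e := by omega
  have h3 := le_antisymm (hw.onesCount_le_of_letterValue hd hid hje)
    (hw.onesCount_le_of_letterValue hd hje hid)
  rw [Multiset.coe_eq_coe, perm_iff_count_true (by simp)]
  exact Int.ofNat_inj.1 h3
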